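/- Let F be a field of characteristic p. (i) If p > 0, there is a constant A_p > 0 depending only on p such that for every n ≥ 1, every t ∈ {0,…,n}, every (n,t)-threshold tuple T, and every ε ∈ (0,1/3), the ε-error probabilistic degree of T over F is at most A_p·(√(t·log(1/ε)) + log(1/ε)). (ii) If p = 0, there is an absolute constant A > 0 such that for every n ≥ 2, every t ∈ {0,…,n}, every (n,t)-threshold tuple T, and every ε ∈ (0,1/3), the ε-error probabilistic degree of T over F is at most A·log n·(√(t·log(1/ε)) + log(1/ε)). -/

import Mathlib

noncomputable section

open scoped BigOperators

/-- Embed a Boolean value into a field: `true ↦ 1`, `false ↦ 0`. -/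
def bF (F : Type) [Field F] (b : Bool) : F := if b then 1 else 0

/-- A finitely supported probability distribution on `m`-tuples of polynomials in
`F[x_1,…,x_n]` (a probabilistic poly-tuple). -/
structure ProbPolyTuple (F : Type) [Field F] (n m : ℕ) where
  k : ℕ
  w : Fin k → ℝ
  w_nonneg : ∀ i, 0 ≤ w i
  w_sum : ∑ i, w i = 1
  poly : Fin k → Fin m → MvPolynomial (Fin n) F

open Classical in
/-- The probability that the probabilistic poly-tuple `P` errs on input `a`
(i.e. that not all `m` coordinates are simultaneously correct). -/
def errTupleAt {F : Type} [Field F] {n m : ℕ} (P : ProbPolyTuple F n m)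
    (f : (Fin n → Bool) → Fin m → Bool) (a : Fin n → Bool) : ℝ :=
  ∑ i, if (∀ j, MvPolynomial.eval (fun v => bF F (a v)) (P.poly i j) = bF F (f a j))
    then 0 else P.w i

/-- The ε-error probabilistic degree of a tuple of Boolean functions over `F`. -/
def pdegTuple (F : Type) [Field F] {n m : ℕ}
    (f : (Fin n → Bool) → Fin m → Bool) (ε : ℝ) : ℕ :=
  sInf {d | ∃ P : ProbPolyTuple F n m,
    (∀ i j, (P.poly i j).totalDegree ≤ d) ∧ ∀ a, errTupleAt P f a ≤ ε}

/-- Hamming weight of a Boolean input. -/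
def wt {n : ℕ} (a : Fin n → Bool) : ℕ := (Finset.univ.filter fun i => a i = true).card

/-- The threshold function `Thr_n^t`. -/
def Thr (n t : ℕ) (a : Fin n → Bool) : Bool := decide (t ≤ wt a)


/-- Boolean vector as a point of the field. -/
def bv (F : Type) [Field F] {n : ℕ} (a : Fin n → Bool) : Fin n → F := fun v => bF F (a v)


lemma eval_esymm_bv (F : Type) [Field F] (n k : ℕ) (x : Fin n → Bool) :
    MvPolynomial.eval (bv F x) (MvPolynomial.esymm (Fin n) F k) = ((wt x).choose k : F) := by
  classical
  rw [MvPolynomial.esymm, map_sum]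
  have h : ∀ s : Finset (Fin n), MvPolynomial.eval (bv F x) (∏ i ∈ s, MvPolynomial.X i)
      = if s ⊆ (Finset.univ.filter fun i => x i = true) then (1 : F) else 0 := by
    intro s
    simp only [map_prod, MvPolynomial.eval_X, bv, bF]
    rw [Finset.prod_ite_zero]
    simp [Finset.subset_iff]
  simp only [h]
  rw [← Finset.sum_filter, Finset.sum_const, nsmul_eq_mul, mul_one]
  congr 1
  rw [wt, ← Finset.card_powersetCard]
  congr 1
  ext s
  simp [Finset.mem_powersetCard, and_comm]

lemma esymm_deg (F : Type) [Field F] (n k : ℕ) :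
    (MvPolynomial.esymm (Fin n) F k).totalDegree ≤ k := by
  rw [MvPolynomial.esymm]
  refine MvPolynomial.totalDegree_finsetSum_le ?_
  intro s hs
  refine (MvPolynomial.totalDegree_finsetProd _ _).trans ?_
  simp only [MvPolynomial.totalDegree_X, Finset.sum_const, smul_eq_mul, mul_one]
  rw [Finset.mem_powersetCard] at hs
  omega

lemma interp (F : Type) [Field F] (n a D : ℕ) (g : ℕ → F) :
    ∃ P : MvPolynomial (Fin n) F, P.totalDegree ≤ D ∧
      ∀ x, a ≤ wt x → wt x ≤ a + D → MvPolynomial.eval (bv F x) P = g (wt x) := by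
  let E : ℕ → MvPolynomial (Fin n) F := fun k => ∑ ij ∈ Finset.HasAntidiagonal.antidiagonal k,
    MvPolynomial.C ((Ring.choose (-(a:ℤ)) ij.1 : ℤ) : F) * MvPolynomial.esymm (Fin n) F ij.2
  refine ⟨∑ k ∈ Finset.range (D+1), MvPolynomial.C ((fwdDiff (1:ℕ))^[k] g a) * E k, ?_, ?_⟩
  · refine MvPolynomial.totalDegree_finsetSum_le ?_
    intro k hk
    refine (MvPolynomial.totalDegree_mul _ _).trans ?_
    rw [MvPolynomial.totalDegree_C, zero_add]
    have : (E k).totalDegree ≤ k := by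
      refine MvPolynomial.totalDegree_finsetSum_le ?_
      intro ij hij
      refine (MvPolynomial.totalDegree_mul _ _).trans ?_
      rw [MvPolynomial.totalDegree_C, zero_add]
      have := esymm_deg F n ij.2
      rw [Finset.HasAntidiagonal.mem_antidiagonal] at hij
      omega
    rw [Finset.mem_range] at hk
    omega
  · intro x h1 h2
    obtain ⟨r, hr⟩ := Nat.exists_eq_add_of_le h1
    have hE : ∀ k, MvPolynomial.eval (bv F x) (E k) = (r.choose k : F) := by
      intro k
      simp only [E, map_sum, map_mul, MvPolynomial.eval_C, eval_esymm_bv]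
      have := Ring.add_choose_eq k (Commute.all (-(a:ℤ)) (wt x : ℤ))
      have e : (-(a:ℤ) + (wt x : ℤ)) = (r : ℤ) := by rw [hr]; push_cast; ring
      rw [e] at this
      simp only [Ring.choose_natCast] at this
      have h3 := congrArg (fun z : ℤ => (z : F)) this
      simp only [Int.cast_sum, Int.cast_mul, Int.cast_natCast] at h3
      rw [h3]
    simp only [map_sum, map_mul, MvPolynomial.eval_C, hE]
    have := shift_eq_sum_fwdDiff_iter (1:ℕ) g r a
    rw [hr]
    rw [smul_eq_mul, mul_one] at this
    rw [this]
    have hrD : r ≤ D := by omega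
    rw [← Finset.sum_subset (Finset.range_subset_range.2 (Nat.succ_le_succ hrD))]
    · refine Finset.sum_congr rfl fun k _ => ?_
      rw [nsmul_eq_mul, mul_comm]
    · intro k _ hk
      rw [Nat.choose_eq_zero_of_lt]
      · simp
      · simp at hk; omega

/-- Exact threshold polynomial on an interval of weights. -/
lemma interpThr (F : Type) [Field F] (n a D t : ℕ) :
    ∃ P : MvPolynomial (Fin n) F, P.totalDegree ≤ D ∧
      ∀ x, a ≤ wt x → wt x ≤ a + D → MvPolynomial.eval (bv F x) P = bF F (Thr n t x) := by
  obtain ⟨P, h1, h2⟩ := interp F n a D (fun w => bF F (decide (t ≤ w)))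
  exact ⟨P, h1, fun x hx hy => by rw [h2 x hx hy, Thr]⟩

/-- Keep coordinate `i` iff `κ i = 0`. -/
def mask {n K : ℕ} (x : Fin n → Bool) (κ : Fin n → Fin K) : Fin n → Bool :=
  fun i => x i && decide ((κ i).val = 0)

lemma pow_wt {n : ℕ} (c : ℝ) (x : Fin n → Bool) :
    c ^ wt x = ∏ i, if x i = true then c else 1 := by
  rw [wt, Finset.prod_ite]; simp

lemma sum_prod_fun {ι Ω : Type} [Fintype ι] [DecidableEq ι] [Fintype Ω] (f : ι → Ω → ℝ) :
    ∑ ω : ι → Ω, ∏ i, f i (ω i) = ∏ i, ∑ k, f i k := by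
  rw [Finset.prod_univ_sum, Fintype.piFinset_univ]

lemma samp_mgf {n K : ℕ} (hK : 1 ≤ K) (x : Fin n → Bool) (c : ℝ) :
    ∑ κ : Fin n → Fin K, c ^ wt (mask x κ) = (K:ℝ)^n * (1 + (c-1)/K) ^ wt x := by
  have hK0 : (K:ℝ) ≠ 0 := by positivity
  have h : ∀ κ : Fin n → Fin K, c ^ wt (mask x κ) =
      ∏ i, (fun i (k : Fin K) => if (x i && decide (k.val = 0)) = true then c else 1) i (κ i) := by
    intro κ
    rw [pow_wt]
    rfl
  rw [Finset.sum_congr rfl (fun κ _ => h κ), sum_prod_fun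
    (fun i (k : Fin K) => if (x i && decide (k.val = 0)) = true then c else 1), pow_wt]
  have : (K:ℝ)^n = ∏ i : Fin n, (K:ℝ) := by simp
  rw [this, ← Finset.prod_mul_distrib]
  refine Finset.prod_congr rfl fun i _ => ?_
  obtain ⟨m, rfl⟩ : ∃ m, K = m + 1 := ⟨K - 1, by omega⟩
  cases hx : x i
  · simp
  · rw [Fin.sum_univ_succ]
    simp
    push_cast at hK0
    field_simp
    ring

lemma markov {Ω : Type} [Fintype Ω] (P : Ω → Prop) [DecidablePred P] (f : Ω → ℝ) (v : ℝ)
    (h0 : ∀ ω, 0 ≤ f ω) (h : ∀ ω, P ω → v ≤ f ω) :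
    ((Finset.univ.filter P).card : ℝ) * v ≤ ∑ ω, f ω := by
  calc ((Finset.univ.filter P).card : ℝ) * v = ∑ ω ∈ Finset.univ.filter P, v := by simp
    _ ≤ ∑ ω ∈ Finset.univ.filter P, f ω := Finset.sum_le_sum fun ω hω => h ω (by simpa using hω)
    _ ≤ ∑ ω, f ω := Finset.sum_le_univ_sum_of_nonneg h0

lemma totalDegree_bind_le {F : Type} [Field F] {m n : ℕ} (f : Fin m → MvPolynomial (Fin n) F)
    (D : ℕ) (hf : ∀ i, (f i).totalDegree ≤ D) (Q : MvPolynomial (Fin m) F) :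
    (MvPolynomial.bind₁ f Q).totalDegree ≤ Q.totalDegree * D := by
  rw [MvPolynomial.bind₁, MvPolynomial.aeval_def, MvPolynomial.eval₂_eq]
  refine MvPolynomial.totalDegree_finsetSum_le ?_
  intro s hs
  refine (MvPolynomial.totalDegree_mul _ _).trans ?_
  rw [MvPolynomial.algebraMap_eq, MvPolynomial.totalDegree_C, zero_add]
  refine (MvPolynomial.totalDegree_finsetProd _ _).trans ?_
  calc ∑ i ∈ s.support, (f i ^ s i).totalDegree ≤ ∑ i ∈ s.support, s i * D :=
        Finset.sum_le_sum fun i _ => (MvPolynomial.totalDegree_pow _ _).trans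
          (Nat.mul_le_mul_left _ (hf i))
    _ = (∑ i ∈ s.support, s i) * D := by rw [Finset.sum_mul]
    _ ≤ Q.totalDegree * D := Nat.mul_le_mul_right _ (MvPolynomial.le_totalDegree hs)

/-- Restriction of a polynomial to the sampled coordinates. -/
def subp {F : Type} [Field F] {n K : ℕ} (κ : Fin n → Fin K) (Q : MvPolynomial (Fin n) F) :
    MvPolynomial (Fin n) F :=
  MvPolynomial.bind₁ (fun i => if (κ i).val = 0 then MvPolynomial.X i else 0) Q

lemma subp_deg {F : Type} [Field F] {n K : ℕ} (κ : Fin n → Fin K) (Q : MvPolynomial (Fin n) F) :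
    (subp κ Q).totalDegree ≤ Q.totalDegree := by
  have := totalDegree_bind_le (F := F)
    (fun i => if (κ i).val = 0 then MvPolynomial.X i else 0) 1 (by
      intro i
      split_ifs <;> simp) Q
  simpa [subp] using this

lemma subp_eval {F : Type} [Field F] {n K : ℕ} (κ : Fin n → Fin K) (Q : MvPolynomial (Fin n) F)
    (x : Fin n → Bool) :
    MvPolynomial.eval (bv F x) (subp κ Q) = MvPolynomial.eval (bv F (mask x κ)) Q := by
  rw [subp, MvPolynomial.eval, MvPolynomial.eval₂Hom_bind₁]
  congr 2
  ext i
  by_cases h : (κ i).val = 0 <;> simp [h, bv, mask, bF]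

open Classical in
/-- All thresholds `≤ t` are simultaneously approximated by a uniform distribution. -/
def Appr (F : Type) [Field F] (n t : ℕ) (d ε : ℝ) : Prop :=
  ∃ (Ω : Type) (_ : Fintype Ω) (_ : Nonempty Ω) (Q : Ω → ℕ → MvPolynomial (Fin n) F),
    (∀ ω, ∀ j ≤ t, ((Q ω j).totalDegree : ℝ) ≤ d) ∧
    ∀ x, ((Finset.univ.filter fun ω => ¬ ∀ j ≤ t,
      MvPolynomial.eval (bv F x) (Q ω j) = bF F (Thr n j x)).card : ℝ) ≤ ε * Fintype.card Ω

lemma cher {n : ℕ} (x : Fin n → Bool) (V s : ℝ) (hV : (wt x : ℝ) ≤ V) (hV0 : 0 < V) (hs : 0 ≤ s) :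
    ((Finset.univ.filter fun κ : Fin n → Fin 2 =>
      s ≤ |2 * (wt (mask x κ) : ℝ) - wt x|).card : ℝ) ≤ 2 * Real.exp (-(s^2/(2*V))) * 2^n := by
  have key : ∀ l : ℝ, ∑ κ : Fin n → Fin 2, Real.exp (l * (2 * (wt (mask x κ) : ℝ) - wt x))
      ≤ 2^n * Real.exp (l^2/2*V) := by
    intro l
    have e : ∀ κ : Fin n → Fin 2, Real.exp (l * (2 * (wt (mask x κ) : ℝ) - wt x))
        = Real.exp (-l) ^ wt x * Real.exp (2*l) ^ wt (mask x κ) := by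
      intro κ
      rw [← Real.exp_nat_mul, ← Real.exp_nat_mul, ← Real.exp_add]
      congr 1; ring
    rw [Finset.sum_congr rfl (fun κ _ => e κ), ← Finset.mul_sum, samp_mgf (by norm_num)]
    have : Real.exp (-l) * (1 + (Real.exp (2*l) - 1)/(2:ℕ)) = Real.cosh l := by
      have h2 : Real.exp (2*l) = Real.exp l * Real.exp l := by rw [← Real.exp_add]; ring_nf
      have h3 : Real.exp (-l) * Real.exp l = 1 := by rw [← Real.exp_add]; simp
      rw [Real.cosh_eq, h2]
      push_cast
      linear_combination (Real.exp l/2) * h3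
    calc _ = (2:ℝ)^n * (Real.exp (-l) * (1 + (Real.exp (2*l) - 1)/(2:ℕ))) ^ wt x := by
            rw [mul_pow]; push_cast; ring
      _ ≤ 2^n * Real.exp (l^2/2*V) := by
        rw [this]
        gcongr
        calc Real.cosh l ^ wt x ≤ Real.exp (l^2/2) ^ wt x :=
              pow_le_pow_left₀ (Real.cosh_pos l).le (Real.cosh_le_exp_half_sq l) _
          _ = Real.exp (wt x * (l^2/2)) := by rw [← Real.exp_nat_mul]
          _ ≤ _ := by
            apply Real.exp_le_exp.2
            rw [mul_comm]
            gcongr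
  have hm := markov (fun κ : Fin n → Fin 2 => s ≤ |2 * (wt (mask x κ) : ℝ) - wt x|)
    (fun κ => Real.exp ((s/V) * (2 * (wt (mask x κ) : ℝ) - wt x)) +
      Real.exp ((-(s/V)) * (2 * (wt (mask x κ) : ℝ) - wt x))) (Real.exp (s^2/V))
    (fun κ => by positivity) (by
      intro κ hκ
      have hsV : 0 ≤ s/V := by positivity
      have e : s^2/V = s/V * s := by ring
      rcases le_abs.1 hκ with h | h
      · have : Real.exp (s^2/V) ≤ Real.exp ((s/V) * (2 * (wt (mask x κ) : ℝ) - wt x)) := by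
          apply Real.exp_le_exp.2; rw [e]; gcongr
        have := Real.exp_pos ((-(s/V)) * (2 * (wt (mask x κ) : ℝ) - wt x))
        linarith
      · have : Real.exp (s^2/V) ≤ Real.exp ((-(s/V)) * (2 * (wt (mask x κ) : ℝ) - wt x)) := by
          apply Real.exp_le_exp.2; rw [e, neg_mul, ← mul_neg]; gcongr
        have := Real.exp_pos ((s/V) * (2 * (wt (mask x κ) : ℝ) - wt x))
        linarith)
  rw [Finset.sum_add_distrib] at hm
  have k1 := key (s/V)
  have k2 := key (-(s/V))
  rw [neg_sq] at k2
  have e1 : (s/V)^2/2*V = s^2/V - s^2/(2*V) := by field_simp; ring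
  have e2 : Real.exp ((s/V)^2/2*V) = Real.exp (s^2/V) * Real.exp (-(s^2/(2*V))) := by
    rw [e1, ← Real.exp_add]; ring_nf
  rw [e2] at k1 k2
  have hp := Real.exp_pos (s^2/V)
  refine le_of_mul_le_mul_right ?_ hp
  linarith

lemma exp_le_half_pow (ℓ : ℕ) (y : ℝ) (h : (ℓ:ℝ) ≤ y) : Real.exp (-y) ≤ (1/2:ℝ)^ℓ := by
  have h1 : Real.exp (-1) ≤ 1/2 := by
    have := Real.exp_one_gt_d9
    rw [Real.exp_neg, one_div]
    apply inv_anti₀ (by norm_num); linarith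
  calc Real.exp (-y) ≤ Real.exp (ℓ * (-1)) := by apply Real.exp_le_exp.2; linarith
    _ = Real.exp (-1) ^ ℓ := by rw [← Real.exp_nat_mul]
    _ ≤ _ := pow_le_pow_left₀ (Real.exp_pos _).le h1 _

open Classical in
lemma step {F : Type} [Field F] {n t ℓ δ : ℕ} {d : ℝ} (hℓ : 8 ≤ ℓ) (ht : 256 * ℓ ≤ t)
    (hδ : 4 * t * ℓ ≤ δ^2) (hδ2 : 4 * δ ≤ t)
    (h : Appr F n ((t+1)/2 + δ) d ((1/2)^(ℓ+1))) : Appr F n t (d + 8 * δ) ((1/2)^ℓ) := by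
  obtain ⟨Ω, hΩ, hne, Q, hdeg, herr⟩ := h
  choose A hA1 hA2 using fun j : ℕ => interpThr F n (j - 4*δ) (8*δ) j
  refine ⟨(Fin n → Fin 2) × Ω, inferInstance, inferInstance, fun p j =>
    subp p.1 (Q p.2 ((j+1)/2 + δ)) +
      (subp p.1 (Q p.2 ((j+1)/2 - δ)) - subp p.1 (Q p.2 ((j+1)/2 + δ))) * A j, ?_, ?_⟩
  · rintro ⟨κ, ω⟩ j hj
    have h1 := hdeg ω ((j+1)/2 + δ) (by omega)
    have h2 := hdeg ω ((j+1)/2 - δ) (by omega)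
    set P1 := subp κ (Q ω ((j+1)/2 + δ)) with hP1
    set P2 := subp κ (Q ω ((j+1)/2 - δ)) with hP2
    have h3 : (P1.totalDegree : ℝ) ≤ d :=
      le_trans (by exact_mod_cast subp_deg κ (Q ω ((j+1)/2 + δ))) h1
    have h4 : (P2.totalDegree : ℝ) ≤ d :=
      le_trans (by exact_mod_cast subp_deg κ (Q ω ((j+1)/2 - δ))) h2
    have h5 := MvPolynomial.totalDegree_add P1 ((P2 - P1) * A j)
    have h6 := MvPolynomial.totalDegree_mul (P2 - P1) (A j)
    have h7 := MvPolynomial.totalDegree_sub P2 P1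
    have h8 := hA1 j
    have h9 : (P1 + (P2 - P1) * A j).totalDegree ≤ P1.totalDegree + 8 * δ ∨
       (P1 + (P2 - P1) * A j).totalDegree ≤ P2.totalDegree + 8 * δ := by omega
    rcases h9 with h9 | h9
    · have : ((P1 + (P2 - P1) * A j).totalDegree : ℝ) ≤ P1.totalDegree + 8 * δ := by
        exact_mod_cast h9
      linarith
    · have : ((P1 + (P2 - P1) * A j).totalDegree : ℝ) ≤ P2.totalDegree + 8 * δ := by
        exact_mod_cast h9
      linarith
  · intro x
    -- the sampling failure event
    obtain ⟨s, hs1, hs2⟩ : ∃ s : ℝ, ((Finset.univ.filter fun κ : Fin n → Fin 2 =>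
        s ≤ |2 * (wt (mask x κ) : ℝ) - wt x|).card : ℝ) ≤ (1/2)^(ℓ+1) * 2^n ∧
        ∀ κ : Fin n → Fin 2, ¬ (s ≤ |2 * (wt (mask x κ) : ℝ) - wt x|) →
          ((wt x ≤ 2 * wt (mask x κ) + 2 * δ ∧ 2 * wt (mask x κ) ≤ wt x + 2 * δ) ∨
          (4 * t < wt x ∧ 3 * wt x ≤ 8 * wt (mask x κ))) := by
      have hgoal : ∀ y : ℝ, (2 * ℓ : ℝ) ≤ y → 2 * Real.exp (-y) * 2^n ≤ (1/2:ℝ)^(ℓ+1) * 2^n := by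
        intro y hy
        have := exp_le_half_pow (ℓ + 2) y (by
          push_cast
          have : (8:ℝ) ≤ ℓ := by exact_mod_cast hℓ
          linarith)
        have e : (1/2:ℝ)^(ℓ+1) = 2 * (1/2)^(ℓ+2) := by ring
        rw [e]
        gcongr
      have htp : (0:ℝ) < t := by
        have : 0 < t := by omega
        exact_mod_cast this
      by_cases hw : wt x ≤ 4 * t
      · refine ⟨2 * δ, (cher x (4 * t) (2 * δ) (by exact_mod_cast hw) (by positivity)
          (by positivity)).trans (hgoal _ ?_), ?_⟩
        · rw [le_div_iff₀ (by positivity)]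
          have : (4 * t * ℓ : ℝ) ≤ δ^2 := by exact_mod_cast hδ
          nlinarith
        · intro κ hκ
          left
          rw [not_le, abs_lt] at hκ
          constructor
          · have : (wt x : ℝ) ≤ 2 * wt (mask x κ) + 2 * δ := by linarith
            exact_mod_cast this
          · have : (2 * wt (mask x κ) : ℝ) ≤ wt x + 2 * δ := by linarith
            exact_mod_cast this
      · push Not at hw
        have hw' : (4 * t : ℝ) < wt x := by exact_mod_cast hw
        have ht' : (256 * ℓ : ℝ) ≤ t := by exact_mod_cast ht
        have hwp : (0:ℝ) < wt x := by linarith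
        refine ⟨wt x / 4, (cher x (wt x) (wt x / 4) le_rfl hwp
          (by positivity)).trans (hgoal _ ?_), ?_⟩
        · have : ((wt x : ℝ) / 4)^2 / (2 * wt x) = wt x / 32 := by field_simp; norm_num
          rw [this]
          have : (0:ℝ) ≤ ℓ := by positivity
          linarith
        · intro κ hκ
          right
          refine ⟨hw, ?_⟩
          rw [not_le, abs_lt] at hκ
          have : (3 * wt x : ℝ) ≤ 8 * wt (mask x κ) := by linarith
          exact_mod_cast this
    let B1 := (Finset.univ.filter fun κ : Fin n → Fin 2 => s ≤ |2 * (wt (mask x κ) : ℝ) - wt x|)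
    let B2 : (Fin n → Fin 2) → Finset Ω := fun κ => Finset.univ.filter fun ω => ¬ ∀ j ≤ (t+1)/2 + δ,
      MvPolynomial.eval (bv F (mask x κ)) (Q ω j) = bF F (Thr n j (mask x κ))
    have hsub : (Finset.univ.filter fun p : (Fin n → Fin 2) × Ω => ¬ ∀ j ≤ t,
      MvPolynomial.eval (bv F x) (subp p.1 (Q p.2 ((j+1)/2 + δ)) +
      (subp p.1 (Q p.2 ((j+1)/2 - δ)) - subp p.1 (Q p.2 ((j+1)/2 + δ))) * A j)
        = bF F (Thr n j x)) ⊆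
        B1 ×ˢ Finset.univ ∪ (Finset.univ.sigma B2).map
          ⟨fun q => (q.1, q.2), by rintro ⟨a, b⟩ ⟨c, d⟩ h; simpa using h⟩ := by
      rintro ⟨κ, ω⟩ hp
      by_contra hcon
      simp only [Finset.mem_union, Finset.mem_product, Finset.mem_univ, and_true, Finset.mem_map,
        Finset.mem_sigma, true_and, not_or] at hcon
      obtain ⟨c1, c2⟩ := hcon
      have c1' : ¬ (s ≤ |2 * (wt (mask x κ) : ℝ) - wt x|) := by simpa [B1] using c1
      have c2' : ∀ j ≤ (t+1)/2 + δ,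
          MvPolynomial.eval (bv F (mask x κ)) (Q ω j) = bF F (Thr n j (mask x κ)) := by
        by_contra hc
        exact c2 ⟨⟨κ, ω⟩, by simpa [B2] using hc, rfl⟩
      rw [Finset.mem_filter] at hp
      refine hp.2 ?_
      intro j hj
      have hcase := hs2 κ c1'
      simp only [map_add, map_mul, map_sub, subp_eval]
      rw [c2' _ (by omega), c2' _ (by omega)]
      by_cases hhi : (j+1)/2 + δ ≤ wt (mask x κ)
      · have hlo : (j+1)/2 - δ ≤ wt (mask x κ) := by omega
        have hj : j ≤ wt x := by omega
        simp [Thr, hhi, hlo, hj, bF]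
      · by_cases hlo : (j+1)/2 - δ ≤ wt (mask x κ)
        · rw [hA2 j x (by omega) (by omega)]
          simp only [Thr, hhi, hlo]
          simp [bF]
        · have hj : ¬ (j ≤ wt x) := by omega
          simp only [Thr, hhi, hlo, hj]
          simp [bF]
    have hcard := (Finset.card_le_card hsub).trans (Finset.card_union_le _ _)
    rw [Finset.card_product, Finset.card_map, Finset.card_sigma, Finset.card_univ] at hcard
    have hcard' := (Nat.cast_le (α := ℝ)).2 hcard
    push_cast at hcard'
    refine hcard'.trans ?_
    have hB2 : ∑ κ : Fin n → Fin 2, ((B2 κ).card : ℝ) ≤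
        ∑ κ : Fin n → Fin 2, (1/2:ℝ)^(ℓ+1) * Fintype.card Ω :=
      Finset.sum_le_sum fun κ _ => herr (mask x κ)
    have hc : (Fintype.card (Fin n → Fin 2) : ℝ) = 2^n := by simp
    rw [Finset.sum_const, Finset.card_univ, nsmul_eq_mul, hc] at hB2
    have hB1 : (B1.card : ℝ) ≤ (1/2)^(ℓ+1) * 2^n := hs1
    have hB1' := mul_le_mul_of_nonneg_right hB1 (Nat.cast_nonneg (α := ℝ) (Fintype.card Ω))
    rw [Fintype.card_prod]
    push_cast
    rw [hc]
    have e : (1/2:ℝ)^ℓ = 2 * (1/2)^(ℓ+1) := by ring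
    rw [e]
    linarith

lemma Appr.mono {F : Type} [Field F] {n t : ℕ} {d d' ε : ℝ} (h : Appr F n t d ε) (hd : d ≤ d') :
    Appr F n t d' ε := by
  obtain ⟨Ω, h1, h2, Q, h3, h4⟩ := h
  exact ⟨Ω, h1, h2, Q, fun ω j hj => (h3 ω j hj).trans hd, h4⟩

lemma induct {F : Type} [Field F] {n : ℕ} {M : ℝ} (hM : 1 ≤ M)
    (base : ∀ ℓ : ℕ, 8 ≤ ℓ → ∀ t ≤ 256 * ℓ, Appr F n t (M * ℓ) ((1/2)^ℓ)) :
    ∀ t ℓ : ℕ, 8 ≤ ℓ → Appr F n t (M * (320 * Real.sqrt (t * ℓ) + ℓ)) ((1/2)^ℓ) := by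
  intro t
  induction t using Nat.strong_induction_on with
  | _ t ih =>
    intro ℓ hℓ
    by_cases ht : t ≤ 256 * ℓ
    · refine (base ℓ hℓ t ht).mono ?_
      have := Real.sqrt_nonneg (t * ℓ)
      gcongr
      linarith
    · push Not at ht
      have hℓ' : (8:ℝ) ≤ ℓ := by exact_mod_cast hℓ
      have ht' : (256 * ℓ : ℝ) ≤ t := by exact_mod_cast ht.le
      set r := Real.sqrt (t * ℓ) with hr
      have hr0 : 0 ≤ r := Real.sqrt_nonneg _
      have hr2 : r^2 = t * ℓ := Real.sq_sqrt (by positivity)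
      have hrt : r ≤ t/16 := by
        apply Real.sqrt_le_iff.2
        constructor
        · positivity
        · nlinarith
      have hr1 : 8 ≤ r := by
        apply Real.le_sqrt_of_sq_le
        nlinarith
      have hδ1 := Nat.le_ceil (2 * r)
      have hδ2 := (Nat.ceil_lt_add_one (show 0 ≤ 2 * r by positivity)).le
      set δ := ⌈2 * r⌉₊ with hδ
      have h4 : 4 * δ ≤ t := by
        have : (4 * δ : ℝ) ≤ t := by linarith
        exact_mod_cast this
      have h5 : 4 * t * ℓ ≤ δ^2 := by
        have : (4 * t * ℓ : ℝ) ≤ δ^2 := by nlinarith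
        exact_mod_cast this
      have ht3 : 4 * ((t+1)/2 + δ) ≤ 3 * t := by
        have : (8 * δ : ℝ) ≤ t + 8 := by linarith
        have : 8 * δ ≤ t + 8 := by exact_mod_cast this
        omega
      have h6 := step (F := F) (n := n) hℓ ht.le h5 h4
        (ih ((t+1)/2 + δ) (by omega) (ℓ+1) (by omega))
      refine h6.mono ?_
      have ht3' : (4 * (((t+1)/2 + δ : ℕ) : ℝ)) ≤ 3 * t := by exact_mod_cast ht3
      have h7 : Real.sqrt ((((t+1)/2 + δ : ℕ) : ℝ) * ((ℓ+1 : ℕ) : ℝ)) ≤ 0.92 * r := by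
        apply Real.sqrt_le_iff.2
        constructor
        · positivity
        · rw [mul_pow, hr2]
          push_cast at ht3' ⊢
          have a1 : (((t+1)/2 : ℕ) : ℝ) + δ ≤ 3/4 * t := by linarith
          have a2 : (ℓ:ℝ) + 1 ≤ 9/8 * ℓ := by linarith
          calc ((((t+1)/2 : ℕ) : ℝ) + δ) * ((ℓ:ℝ)+1) ≤ (3/4 * t) * (9/8 * ℓ) := by gcongr
            _ ≤ _ := by
              have : (0:ℝ) ≤ t * ℓ := by positivity
              nlinarith
      have h8 : M * (320 * Real.sqrt ((((t+1)/2 + δ : ℕ) : ℝ) * ((ℓ+1 : ℕ) : ℝ)) + ((ℓ+1 : ℕ) : ℝ))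
          ≤ M * (320 * (0.92 * r) + ((ℓ+1 : ℕ) : ℝ)) := by gcongr
      refine (add_le_add_left h8 _).trans ?_
      push_cast
      nlinarith

lemma pdeg_le {F : Type} [Field F] {n t m : ℕ} {d ε : ℝ} (ts : Fin m → ℕ) (hts : ∀ j, ts j ≤ t)
    (hd : 0 ≤ d) (h : Appr F n t d ε) : (pdegTuple F (fun a j => Thr n (ts j) a) ε : ℝ) ≤ d := by
  classical
  obtain ⟨Ω, h1, h2, Q, h3, h4⟩ := h
  have hc : (0:ℝ) < Fintype.card Ω := by exact_mod_cast Fintype.card_pos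
  refine le_trans ?_ (Nat.floor_le hd)
  norm_cast
  refine Nat.sInf_le ⟨⟨Fintype.card Ω, fun _ => 1 / Fintype.card Ω, fun _ => by positivity,
    by simp [hc.ne'], fun i j => Q ((Fintype.equivFin Ω).symm i) (ts j)⟩, ?_, ?_⟩
  · intro i j
    exact Nat.le_floor (h3 _ _ (hts j))
  · intro a
    simp only [errTupleAt]
    rw [(Fintype.equivFin Ω).symm.sum_comp (fun ω => if (∀ j, MvPolynomial.eval
      (fun v => bF F (a v)) (Q ω (ts j)) = bF F (Thr n (ts j) a)) then (0:ℝ)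
      else 1 / Fintype.card Ω)]
    have : ∀ ω, (if (∀ j, MvPolynomial.eval
      (fun v => bF F (a v)) (Q ω (ts j)) = bF F (Thr n (ts j) a)) then (0:ℝ)
      else 1 / Fintype.card Ω) ≤ if (¬ ∀ j ≤ t,
      MvPolynomial.eval (bv F a) (Q ω j) = bF F (Thr n j a)) then 1 / (Fintype.card Ω : ℝ) else 0 := by
      intro ω
      by_cases hω : ∀ j ≤ t, MvPolynomial.eval (bv F a) (Q ω j) = bF F (Thr n j a)
      · have hω' : ∀ j, MvPolynomial.eval (fun v => bF F (a v)) (Q ω (ts j))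
            = bF F (Thr n (ts j) a) := fun j => hω _ (hts j)
        rw [if_pos hω', if_neg (not_not.2 hω)]
      · rw [if_pos hω]
        split_ifs
        · positivity
        · exact le_rfl
    refine (Finset.sum_le_sum fun ω _ => this ω).trans ?_
    rw [← Finset.sum_filter, Finset.sum_const, nsmul_eq_mul, mul_one_div, div_le_iff₀ hc]
    exact h4 a

lemma final {F : Type} [Field F] {n t m : ℕ} {M ε : ℝ} (hM : 1 ≤ M)
    (base : ∀ ℓ : ℕ, 8 ≤ ℓ → ∀ t ≤ 256 * ℓ, Appr F n t (M * ℓ) ((1/2)^ℓ))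
    (ts : Fin m → ℕ) (hts : ∀ j, ts j ≤ t) (h0 : 0 < ε) (h1 : ε < 1/3) :
    (pdegTuple F (fun a j => Thr n (ts j) a) ε : ℝ)
      ≤ 1280 * M * (Real.sqrt (t * Real.logb 2 (1/ε)) + Real.logb 2 (1/ε)) := by
  set L := Real.logb 2 (1/ε) with hL
  have hL1 : 1 ≤ L := by
    rw [hL, Real.le_logb_iff_rpow_le (by norm_num) (by positivity), Real.rpow_one,
      le_div_iff₀ h0]
    linarith
  have hc1 := Nat.le_ceil L
  have hc2 := (Nat.ceil_lt_add_one (show 0 ≤ L by linarith)).le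
  set c := ⌈L⌉₊ with hc
  have hcpos : 1 ≤ c := by
    have : (1:ℝ) ≤ c := by linarith
    exact_mod_cast this
  have hA := induct hM base t (8 * c) (by omega)
  have hε : (1/2:ℝ)^(8*c) ≤ ε := by
    have e1 : (1/2:ℝ)^(8*c) ≤ (1/2)^c :=
      pow_le_pow_of_le_one (by norm_num) (by norm_num) (by omega)
    refine e1.trans ?_
    have e2 : 1/ε ≤ (2:ℝ)^c := by
      rw [← Real.rpow_natCast, ← Real.logb_le_iff_le_rpow (by norm_num) (by positivity)]
      exact hc1
    rw [one_div_pow]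
    rw [div_le_iff₀ h0] at e2
    rw [div_le_iff₀ (by positivity)]
    linarith
  have hA' : Appr F n t (M * (320 * Real.sqrt (t * ((8*c : ℕ) : ℝ)) + ((8*c : ℕ) : ℝ))) ε := by
    obtain ⟨Ω, h1, h2, Q, h3, h4⟩ := hA
    refine ⟨Ω, h1, h2, Q, h3, fun x => (h4 x).trans ?_⟩
    gcongr
  refine (pdeg_le ts hts (by positivity) hA').trans ?_
  have h16 : ((8*c : ℕ) : ℝ) ≤ 16 * L := by push_cast; linarith
  have hs : Real.sqrt (t * ((8*c : ℕ) : ℝ)) ≤ 4 * Real.sqrt (t * L) := by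
    have : (4:ℝ) = Real.sqrt 16 := by
      rw [show (16:ℝ) = 4^2 by norm_num, Real.sqrt_sq (by norm_num)]
    rw [this, ← Real.sqrt_mul (by norm_num)]
    apply Real.sqrt_le_sqrt
    calc (t:ℝ) * ((8*c : ℕ) : ℝ) ≤ t * (16 * L) := by gcongr
      _ = 16 * (t * L) := by ring
  calc _ ≤ M * (320 * (4 * Real.sqrt (t * L)) + 16 * L) := by gcongr
    _ ≤ M * (1280 * Real.sqrt (t * L) + 1280 * L) := by
      apply mul_le_mul_of_nonneg_left _ (by linarith)
      linarith
    _ = _ := by ring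

open Classical in
lemma base_of_Z {F : Type} [Field F] {n T D : ℕ} {dZ ε : ℝ} (Ω : Type) [Fintype Ω] [Nonempty Ω]
    (Z : Ω → MvPolynomial (Fin n) F) (hZ : ∀ ω, ((Z ω).totalDegree : ℝ) ≤ dZ)
    (hTD : T ≤ D)
    (h : ∀ x, ((Finset.univ.filter fun ω =>
      ¬ ((wt x < T → MvPolynomial.eval (bv F x) (Z ω) = 1) ∧
        (D < wt x → MvPolynomial.eval (bv F x) (Z ω) = 0))).card : ℝ) ≤ ε * Fintype.card Ω) :
    ∀ t ≤ T, Appr F n t (D + dZ) ε := by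
  intro t ht
  choose A hA1 hA2 using fun j : ℕ => interpThr F n 0 D j
  refine ⟨Ω, inferInstance, inferInstance, fun ω j => 1 - (1 - A j) * Z ω, ?_, ?_⟩
  · intro ω j hj
    have h1 := MvPolynomial.totalDegree_sub 1 ((1 - A j) * Z ω)
    have h2 := MvPolynomial.totalDegree_mul (1 - A j) (Z ω)
    have h3 := MvPolynomial.totalDegree_sub 1 (A j)
    rw [MvPolynomial.totalDegree_one] at h1 h3
    have h4 := hA1 j
    have h5 : (1 - (1 - A j) * Z ω).totalDegree ≤ D + (Z ω).totalDegree := by omega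
    have h6 : ((1 - (1 - A j) * Z ω).totalDegree : ℝ) ≤ D + (Z ω).totalDegree := by
      exact_mod_cast h5
    linarith [hZ ω]
  · intro x
    refine le_trans ?_ (h x)
    norm_cast
    apply Finset.card_le_card
    intro ω hω
    rw [Finset.mem_filter] at hω ⊢
    refine ⟨Finset.mem_univ _, fun hcon => hω.2 ?_⟩
    intro j hj
    simp only [map_sub, map_mul, map_one]
    by_cases hw : wt x ≤ D
    · rw [hA2 j x (by omega) (by omega)]
      by_cases hwT : wt x < T
      · rw [hcon.1 hwT]; ring
      · have : j ≤ wt x := by omega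
        simp [Thr, this, bF]
    · rw [hcon.2 (by omega)]
      have : j ≤ wt x := by omega
      simp [Thr, this, bF]

lemma wt_mask_le {n K : ℕ} (x : Fin n → Bool) (κ : Fin n → Fin K) : wt (mask x κ) ≤ wt x := by
  apply Finset.card_le_card
  intro i
  simp [mask]
  tauto

lemma one_add_pow_le_exp (y : ℝ) (hy : 0 ≤ 1 + y) (w : ℕ) : (1 + y)^w ≤ Real.exp (w * y) := by
  rw [Real.exp_nat_mul]
  apply pow_le_pow_left₀ hy
  linarith [Real.add_one_le_exp y]

lemma sample_ok {n K T ℓ : ℕ} (hK : 1 ≤ K) (x : Fin n → Bool)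
    (h1 : wt x ≤ K * (4 * (T + ℓ + 1))) (h2 : K * (2 * (T + ℓ + 1)) ≤ wt x) :
    ((Finset.univ.filter fun κ : Fin n → Fin K =>
      ¬ (T ≤ wt (mask x κ) ∧ wt (mask x κ) ≤ 8 * (T + ℓ + 1))).card : ℝ) ≤ (1/2)^ℓ * (K:ℝ)^n := by
  classical
  set G := T + ℓ + 1 with hG
  have hK1 : (1:ℝ) ≤ K := by exact_mod_cast hK
  have hKp : (0:ℝ) < K := by linarith
  have h1' : (wt x : ℝ) ≤ K * (4 * G) := by exact_mod_cast h1
  have h2' : K * (2 * G) ≤ (wt x : ℝ) := by exact_mod_cast h2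
  have up := markov (fun κ : Fin n → Fin K => 8 * G < wt (mask x κ))
    (fun κ => (2:ℝ) ^ wt (mask x κ)) (2^(8*G)) (fun κ => by positivity)
    (fun κ h => pow_le_pow_right₀ (by norm_num) h.le)
  have lo := markov (fun κ : Fin n → Fin K => wt (mask x κ) < T)
    (fun κ => (1/2:ℝ) ^ wt (mask x κ)) ((1/2)^T) (fun κ => by positivity)
    (fun κ h => pow_le_pow_of_le_one (by norm_num) (by norm_num) h.le)
  rw [samp_mgf hK] at up lo
  have up2 : (1 + ((2:ℝ)-1)/K)^wt x ≤ (2:ℝ)^(8*G) * (1/2)^(2*G) := by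
    refine (one_add_pow_le_exp _ (by norm_num; positivity) _).trans ?_
    calc Real.exp (wt x * ((2-1)/K)) ≤ Real.exp (G * 4) := by
          apply Real.exp_le_exp.2
          rw [← mul_div_assoc, div_le_iff₀ hKp]
          linarith
      _ = Real.exp 4 ^ G := by rw [← Real.exp_nat_mul]
      _ ≤ 64 ^ G := by
        apply pow_le_pow_left₀ (Real.exp_pos _).le
        have : Real.exp 4 = Real.exp 1 ^ 4 := by rw [← Real.exp_nat_mul]; norm_num
        rw [this]
        calc Real.exp 1 ^ 4 ≤ 2.8 ^ 4 := by
              apply pow_le_pow_left₀ (Real.exp_pos _).le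
              linarith [Real.exp_one_lt_d9]
          _ ≤ 64 := by norm_num
      _ = _ := by rw [pow_mul, pow_mul, ← mul_pow]; norm_num
  have lo2 : (1 + ((1/2:ℝ)-1)/K)^wt x ≤ (1/2)^G := by
    refine (one_add_pow_le_exp _ ?_ _).trans ?_
    · have : ((1/2:ℝ)-1)/K = -(1/(2*K)) := by field_simp; norm_num
      rw [this]
      have : 1/(2*(K:ℝ)) ≤ 1 := by rw [div_le_one (by positivity)]; linarith
      linarith
    · have : (wt x : ℝ) * (((1/2:ℝ)-1)/K) = -(wt x / (2 * K)) := by field_simp; norm_num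
      rw [this]
      apply exp_le_half_pow
      rw [le_div_iff₀ (by positivity)]
      linarith
  have hKn : (0:ℝ) < (K:ℝ)^n := by positivity
  have up3 : ((Finset.univ.filter fun κ : Fin n → Fin K => 8 * G < wt (mask x κ)).card : ℝ)
      ≤ (1/2)^(ℓ+1) * (K:ℝ)^n := by
    have e : (1/2:ℝ)^(2*G) ≤ (1/2)^(ℓ+1) :=
      pow_le_pow_of_le_one (by norm_num) (by norm_num) (by omega)
    have hp : (0:ℝ) < 2^(8*G) := by positivity
    refine le_of_mul_le_mul_right (up.trans ?_) hp
    calc (K:ℝ)^n * (1 + ((2:ℝ)-1)/K)^wt x ≤ (K:ℝ)^n * ((2:ℝ)^(8*G) * (1/2)^(ℓ+1)) := by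
          gcongr
          exact up2.trans (by gcongr)
      _ = _ := by ring
  have lo3 : ((Finset.univ.filter fun κ : Fin n → Fin K => wt (mask x κ) < T).card : ℝ)
      ≤ (1/2)^(ℓ+1) * (K:ℝ)^n := by
    have hp : (0:ℝ) < (1/2)^T := by positivity
    refine le_of_mul_le_mul_right (lo.trans ?_) hp
    calc (K:ℝ)^n * (1 + ((1/2:ℝ)-1)/K)^wt x ≤ (K:ℝ)^n * (1/2)^G := by gcongr
      _ = _ := by rw [hG]; ring
  have hsub : (Finset.univ.filter fun κ : Fin n → Fin K =>
      ¬ (T ≤ wt (mask x κ) ∧ wt (mask x κ) ≤ 8 * G)) ⊆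
      (Finset.univ.filter fun κ : Fin n → Fin K => 8 * G < wt (mask x κ)) ∪
      (Finset.univ.filter fun κ : Fin n → Fin K => wt (mask x κ) < T) := by
    intro κ
    simp only [Finset.mem_filter, Finset.mem_union, Finset.mem_univ, true_and]
    omega
  have hc := (Nat.cast_le (α := ℝ)).2 ((Finset.card_le_card hsub).trans (Finset.card_union_le _ _))
  push_cast at hc
  have e : (1/2:ℝ)^ℓ = 2 * (1/2)^(ℓ+1) := by ring
  rw [e]
  linarith

lemma card_pi_filter {ι : Type} [Fintype ι] [DecidableEq ι] (β : ι → Type) [∀ i, Fintype (β i)]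
    (i : ι) (P : β i → Prop) [DecidablePred P] :
    (Finset.univ.filter fun ω : (∀ j, β j) => P (ω i)).card * Fintype.card (β i)
      = (Finset.univ.filter P).card * Fintype.card (∀ j, β j) := by
  classical
  have e := Fintype.card_congr (Equiv.piSplitAt i β)
  rw [Fintype.card_prod] at e
  have h : (Finset.univ.filter fun ω : (∀ j, β j) => P (ω i)).card
      = (Finset.univ.filter P).card * Fintype.card (∀ j : {j // j ≠ i}, β j) := by
    rw [← Finset.card_univ (α := ∀ j : {j // j ≠ i}, β j), ← Finset.card_product,
      ← Finset.card_map (Equiv.piSplitAt i β).toEmbedding]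
    congr 1
    ext ⟨a, b⟩
    simp only [Finset.mem_map_equiv, Finset.mem_filter, Finset.mem_univ, true_and,
      Finset.mem_product, and_true]
    simp [Equiv.piSplitAt]
  rw [h, e]
  ring

lemma wt_le {n : ℕ} (x : Fin n → Bool) : wt x ≤ n := by
  have := Finset.card_filter_le (Finset.univ : Finset (Fin n)) (fun i => x i = true)
  simpa [wt] using this

lemma base0 {F : Type} [Field F] {n : ℕ} (hn : 2 ≤ n) :
    ∀ ℓ : ℕ, 8 ≤ ℓ → ∀ t ≤ 256 * ℓ, Appr F n t (6192 * Real.logb 2 n * ℓ) ((1/2)^ℓ) := by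
  classical
  intro ℓ hℓ t ht
  set T := 256 * ℓ with hT
  set D := 8 * (T + ℓ + 1) with hD
  obtain ⟨A, hA1, hA2⟩ := interpThr F n 0 D T
  set I := Nat.log 2 n with hI
  have hlog : (I : ℝ) ≤ Real.logb 2 n := by
    rw [Real.le_logb_iff_rpow_le (by norm_num) (by positivity), Real.rpow_natCast]
    exact_mod_cast Nat.pow_log_le_self 2 (by omega)
  have hI1 : 1 ≤ I := by
    rw [hI]; exact Nat.log_pos (by norm_num) hn
  have hI1' : (1:ℝ) ≤ I := by exact_mod_cast hI1
  have := base_of_Z (F := F) (n := n) (T := T) (D := D) (dZ := (I+1) * D) (ε := (1/2)^ℓ)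
    (∀ i : Fin (I+1), Fin n → Fin (2^(i:ℕ)))
    (fun ω => ∏ i, (1 - subp (ω i) A)) ?_ (by omega) ?_ t ht
  · refine this.mono ?_
    have hD' : (D:ℝ) ≤ 2064 * ℓ := by
      have : D ≤ 2064 * ℓ := by omega
      exact_mod_cast this
    have h0 : (0:ℝ) ≤ D := by positivity
    calc (D:ℝ) + (I+1) * D = (I+2) * D := by ring
      _ ≤ (3 * Real.logb 2 n) * (2064 * ℓ) :=
        mul_le_mul (by linarith) hD' h0 (by linarith)
      _ = _ := by ring
  · intro ω
    have h1 : (∏ i, (1 - subp (ω i) A)).totalDegree ≤ (I+1) * D := by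
      refine (MvPolynomial.totalDegree_finsetProd _ _).trans ?_
      calc _ ≤ ∑ i : Fin (I+1), D := by
            refine Finset.sum_le_sum fun i _ => ?_
            have h1 := MvPolynomial.totalDegree_sub 1 (subp (ω i) A)
            have h2 := subp_deg (ω i) A
            rw [MvPolynomial.totalDegree_one] at h1
            omega
        _ = _ := by simp
    exact_mod_cast h1
  · intro x
    have hev : ∀ ω : (∀ i : Fin (I+1), Fin n → Fin (2^(i:ℕ))),
        MvPolynomial.eval (bv F x) (∏ i, (1 - subp (ω i) A))
        = ∏ i, (1 - MvPolynomial.eval (bv F (mask x (ω i))) A) := by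
      intro ω
      simp [map_prod, subp_eval]
    by_cases hw : wt x ≤ D
    · rw [Finset.filter_false_of_mem]
      · simp; positivity
      · intro ω _ hcon
        apply hcon
        refine ⟨fun hT' => ?_, fun h => by omega⟩
        rw [hev]
        refine Finset.prod_eq_one fun i _ => ?_
        have h1 := wt_mask_le x (ω i)
        rw [hA2 _ (by omega) (by omega)]
        have h2 : ¬ (T ≤ wt (mask x (ω i))) := by omega
        simp [Thr, h2, bF]
    · push Not at hw
      have hex : ∃ i, wt x ≤ 2^i * (4 * (T + ℓ + 1)) := by
        refine ⟨I, ?_⟩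
        have h1 := wt_le x
        have h2 : n < 2^(I+1) := Nat.lt_pow_succ_log_self (by norm_num) n
        rw [pow_succ] at h2
        nlinarith
      have hi1 := Nat.find_spec hex
      set i := Nat.find hex with hi
      have hiI : i ≤ I := by
        apply Nat.find_min'
        have h1 := wt_le x
        have h2 : n < 2^(I+1) := Nat.lt_pow_succ_log_self (by norm_num) n
        rw [pow_succ] at h2
        nlinarith
      have hi2 : 2^i * (2 * (T + ℓ + 1)) ≤ wt x := by
        rcases Nat.eq_zero_or_pos i with h0 | h0
        · rw [h0]; omega
        · have := Nat.find_min hex (m := i - 1) (by omega)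
          push Not at this
          obtain ⟨k, hk⟩ : ∃ k, i = k + 1 := ⟨i - 1, by omega⟩
          rw [hk] at this ⊢
          rw [pow_succ]
          simp only [Nat.add_sub_cancel] at this
          linarith
      have hs := sample_ok (K := 2^i) (T := T) (ℓ := ℓ) Nat.one_le_two_pow x hi1 hi2
      have hp := card_pi_filter (fun i : Fin (I+1) => Fin n → Fin (2^(i:ℕ))) ⟨i, by omega⟩
        (fun κ => ¬ (T ≤ wt (mask x κ) ∧ wt (mask x κ) ≤ 8 * (T + ℓ + 1)))
      have hp' := congrArg (Nat.cast (R := ℝ)) hp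
      rw [Nat.cast_mul, Nat.cast_mul] at hp'
      have hcard : (Fintype.card (Fin n → Fin (2^i)) : ℝ) = ((2^i : ℕ) : ℝ)^n := by simp
      have hpos : (0:ℝ) < ((2^i : ℕ) : ℝ)^n := by positivity
      have hle : ((Finset.univ.filter fun ω : (∀ i : Fin (I+1), Fin n → Fin (2^(i:ℕ))) =>
          ¬ (T ≤ wt (mask x (ω ⟨i, by omega⟩)) ∧
            wt (mask x (ω ⟨i, by omega⟩)) ≤ 8 * (T + ℓ + 1))).card : ℝ)
          ≤ (1/2)^ℓ * Fintype.card (∀ i : Fin (I+1), Fin n → Fin (2^(i:ℕ))) := by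
        refine le_of_mul_le_mul_right ?_ hpos
        rw [← hcard]
        refine hp'.le.trans ?_
        rw [hcard]
        refine (mul_le_mul_of_nonneg_right hs (Nat.cast_nonneg _)).trans ?_
        apply le_of_eq
        ring
      refine le_trans ?_ hle
      norm_cast
      apply Finset.card_le_card
      intro ω hω
      rw [Finset.mem_filter] at hω ⊢
      refine ⟨Finset.mem_univ _, fun hcon => hω.2 ⟨fun h => by omega, fun _ => ?_⟩⟩
      rw [hev]
      refine Finset.prod_eq_zero (Finset.mem_univ (⟨i, by omega⟩ : Fin (I+1))) ?_
      rw [hA2 _ (by omega) (by omega)]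
      simp [Thr, hcon.1, bF]

/-- The number of sampled ones that survive both the mask and the random bits. -/
def rowv {n K : ℕ} (x : Fin n → Bool) (ρ : (Fin n → Fin K) × (Fin n → Bool)) : ℕ :=
  wt (fun i => mask x ρ.1 i && ρ.2 i)

lemma wt_update {n : ℕ} (y : Fin n → Bool) (i : Fin n) :
    wt (Function.update y i true) = wt (Function.update y i false) + 1 := by
  have h : (Finset.univ.filter fun j => Function.update y i true j = true) =
      insert i (Finset.univ.filter fun j => Function.update y i false j = true) := by
    ext j
    by_cases hj : j = i
    · subst hj; simp
    · simp [Function.update_of_ne hj, hj]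
  rw [wt, h, Finset.card_insert_of_notMem (by simp), wt]

lemma toggle {n p : ℕ} (hp : p.Prime) (m : Fin n → Bool) (hm : wt m ≠ 0) :
    2 * (Finset.univ.filter fun r : Fin n → Bool => p ∣ wt (fun i => m i && r i)).card ≤ 2^n := by
  obtain ⟨i, hi⟩ : ∃ i, m i = true := by
    by_contra hcon
    push Not at hcon
    apply hm
    rw [wt, Finset.card_eq_zero, Finset.filter_eq_empty_iff]
    intro j _
    exact hcon j
  have hupd : ∀ (r : Fin n → Bool) (b : Bool), (fun j => m j && (Function.update r i b) j)
      = Function.update (fun j => m j && r j) i b := by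
    intro r b
    ext j
    by_cases hj : j = i
    · subst hj; simp [hi]
    · simp [Function.update_of_ne hj]
  have hle : (Finset.univ.filter fun r : Fin n → Bool => p ∣ wt (fun i => m i && r i)).card ≤
      (Finset.univ.filter fun r : Fin n → Bool => ¬ p ∣ wt (fun i => m i && r i)).card := by
    apply Finset.card_le_card_of_injOn (fun r => Function.update r i (!r i))
    · intro r hr
      simp only [Finset.coe_filter, Finset.mem_univ, true_and, Set.mem_ofPred_eq] at hr ⊢
      rw [hupd]
      have hw := wt_update (fun j => m j && r j) i
      have hself : wt (fun j => m j && r j)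
          = wt (Function.update (fun j => m j && r j) i (r i)) := by
        congr 1
        rw [← hupd]
        simp
      rw [hself] at hr
      intro hd
      cases hri : r i
      · rw [hri] at hr hd
        simp only [Bool.not_false] at hd
        rw [hw] at hd
        exact hp.one_lt.ne' (Nat.dvd_one.1 ((Nat.dvd_add_right hr).1 hd))
      · rw [hri] at hr hd
        simp only [Bool.not_true] at hd
        rw [hw] at hr
        exact hp.one_lt.ne' (Nat.dvd_one.1 ((Nat.dvd_add_right hd).1 hr))
    · intro r _ r' _ h
      have h' : Function.update r i (!r i) = Function.update r' i (!r' i) := h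
      ext j
      by_cases hj : j = i
      · subst hj
        have := congrFun h' j
        simpa using this
      · have := congrFun h' j
        simpa [Function.update_of_ne hj] using this
  have hs := Finset.card_filter_add_card_filter_not (s := (Finset.univ : Finset (Fin n → Bool)))
    (fun r : Fin n → Bool => p ∣ wt (fun i => m i && r i))
  have hc : (Finset.univ : Finset (Fin n → Bool)).card = 2^n := by simp
  omega

lemma card_nohit {n K : ℕ} (hK : 1 ≤ K) (x : Fin n → Bool) :
    ((Finset.univ.filter fun κ : Fin n → Fin K => wt (mask x κ) = 0).card : ℝ)
      = (K:ℝ)^n * (1 - 1/K)^wt x := by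
  have h := samp_mgf hK x 0
  rw [show (1:ℝ) + (0-1)/K = 1 - 1/K by ring] at h
  rw [← h, Finset.card_filter]
  push_cast
  refine Finset.sum_congr rfl fun κ _ => ?_
  by_cases hw : wt (mask x κ) = 0 <;> simp [hw]

/-- Number of rows with zero value mod `p` (upper bound). -/
lemma row_zero {n K p : ℕ} (hp : p.Prime) (hK : 1 ≤ K) (x : Fin n → Bool) :
    ((Finset.univ.filter fun ρ : (Fin n → Fin K) × (Fin n → Bool) => p ∣ rowv x ρ).card : ℝ)
      ≤ (K:ℝ)^n * 2^n * (1/2 + (1 - 1/K)^wt x / 2) := by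
  have e : (Finset.univ.filter fun ρ : (Fin n → Fin K) × (Fin n → Bool) => p ∣ rowv x ρ).card
      = ∑ κ : Fin n → Fin K,
        (Finset.univ.filter fun r : Fin n → Bool => p ∣ wt (fun i => mask x κ i && r i)).card := by
    rw [Finset.card_filter, ← Finset.univ_product_univ, Finset.sum_product]
    refine Finset.sum_congr rfl fun κ _ => ?_
    rw [Finset.card_filter]
    rfl
  rw [e]
  push_cast
  have hb : ∀ κ : Fin n → Fin K,
      ((Finset.univ.filter fun r : Fin n → Bool => p ∣ wt (fun i => mask x κ i && r i)).card : ℝ)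
      ≤ 2^n/2 + (2^n/2) * (if wt (mask x κ) = 0 then 1 else 0) := by
    intro κ
    split_ifs with h
    · have := Finset.card_filter_le (Finset.univ : Finset (Fin n → Bool))
        (fun r : Fin n → Bool => p ∣ wt (fun i => mask x κ i && r i))
      have hc : (Finset.univ : Finset (Fin n → Bool)).card = 2^n := by simp
      rw [hc] at this
      have h2 := (Nat.cast_le (α := ℝ)).2 this
      push_cast at h2
      linarith
    · have h2 := (Nat.cast_le (α := ℝ)).2 (toggle hp (mask x κ) h)
      push_cast at h2
      linarith
  refine (Finset.sum_le_sum fun κ _ => hb κ).trans ?_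
  rw [Finset.sum_add_distrib, ← Finset.mul_sum, Finset.sum_boole, card_nohit hK, Finset.sum_const,
    nsmul_eq_mul]
  have hc : ((Finset.univ : Finset (Fin n → Fin K)).card : ℝ) = (K:ℝ)^n := by simp
  rw [hc]
  apply le_of_eq
  ring

/-- Number of rows with nonzero value mod `p` (upper bound). -/
lemma row_nonzero {n K p : ℕ} (hK : 1 ≤ K) (x : Fin n → Bool) :
    ((Finset.univ.filter fun ρ : (Fin n → Fin K) × (Fin n → Bool) => ¬ p ∣ rowv x ρ).card : ℝ)
      ≤ (K:ℝ)^n * 2^n * (wt x / K) := by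
  have hK1 : (1:ℝ) ≤ K := by exact_mod_cast hK
  have hsub : (Finset.univ.filter fun ρ : (Fin n → Fin K) × (Fin n → Bool) => ¬ p ∣ rowv x ρ) ⊆
      (Finset.univ.filter fun κ : Fin n → Fin K => ¬ wt (mask x κ) = 0) ×ˢ Finset.univ := by
    rintro ⟨κ, r⟩ h
    simp only [Finset.mem_filter, Finset.mem_univ, true_and, Finset.mem_product, and_true] at h ⊢
    intro h0
    apply h
    have : rowv x (κ, r) = 0 := by
      have : rowv x (κ, r) ≤ wt (mask x κ) := by
        rw [rowv, wt, wt]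
        apply Finset.card_le_card
        intro i
        simp
        tauto
      omega
    rw [this]
    exact dvd_zero p
  have h1 := Finset.card_le_card hsub
  rw [Finset.card_product] at h1
  have hs := Finset.card_filter_add_card_filter_not (s := (Finset.univ : Finset (Fin n → Fin K)))
    (fun κ => wt (mask x κ) = 0)
  have hc : (Finset.univ : Finset (Fin n → Fin K)).card = K^n := by simp
  have hc2 : (Finset.univ : Finset (Fin n → Bool)).card = 2^n := by simp
  rw [hc] at hs
  rw [hc2] at h1
  have hs' := congrArg (Nat.cast (R := ℝ)) hs
  have h1' := (Nat.cast_le (α := ℝ)).2 h1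
  push_cast at hs' h1'
  rw [card_nohit hK] at hs'
  have hber := one_add_mul_le_pow (a := -(1/(K:ℝ))) (by
    have : 1/(K:ℝ) ≤ 1 := by rw [div_le_one (by linarith)]; exact hK1
    linarith) (wt x)
  rw [← sub_eq_add_neg] at hber
  refine h1'.trans ?_
  have hKn : (0:ℝ) < (K:ℝ)^n := by positivity
  have : ((Finset.univ.filter fun κ : Fin n → Fin K => ¬ wt (mask x κ) = 0).card : ℝ)
      ≤ (K:ℝ)^n * (wt x / K) := by
    have h3 := mul_le_mul_of_nonneg_left hber hKn.le
    have e : (K:ℝ)^n * (1 + wt x * -(1/K)) = (K:ℝ)^n - (K:ℝ)^n * (wt x / K) := by ring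
    linarith
  calc _ ≤ ((K:ℝ)^n * (wt x / K)) * 2^n := by gcongr
    _ = _ := by ring

/-- The Boolean vector of row values. -/
def rowY {n K B : ℕ} (p : ℕ) (x : Fin n → Bool) (ω : Fin B → (Fin n → Fin K) × (Fin n → Bool)) :
    Fin B → Bool := fun b => decide (¬ p ∣ rowv x (ω b))

lemma rowY_mgf {n K B : ℕ} (p : ℕ) (x : Fin n → Bool) (c : ℝ) :
    ∑ ω : Fin B → (Fin n → Fin K) × (Fin n → Bool), c ^ wt (rowY p x ω) =
      (c * (Finset.univ.filter fun ρ : (Fin n → Fin K) × (Fin n → Bool) => ¬ p ∣ rowv x ρ).card +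
        (Finset.univ.filter fun ρ : (Fin n → Fin K) × (Fin n → Bool) => p ∣ rowv x ρ).card)^B := by
  have h : ∀ ω : Fin B → (Fin n → Fin K) × (Fin n → Bool), c ^ wt (rowY p x ω) =
      ∏ b, (fun _ ρ => if ¬ p ∣ rowv x ρ then c else 1) b (ω b) := by
    intro ω
    rw [pow_wt]
    refine Finset.prod_congr rfl fun b _ => ?_
    simp [rowY]
  rw [Finset.sum_congr rfl (fun ω _ => h ω), sum_prod_fun
    (fun (_ : Fin B) (ρ : (Fin n → Fin K) × (Fin n → Bool)) => if ¬ p ∣ rowv x ρ then c else 1)]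
  rw [Finset.prod_const, Finset.card_univ, Fintype.card_fin, Finset.sum_ite, Finset.sum_const,
    Finset.sum_const, nsmul_eq_mul, nsmul_eq_mul, mul_one, mul_comm]
  simp only [not_not]

/-- The linear form of a row. -/
def rowP (F : Type) [Field F] {n K : ℕ} (ρ : (Fin n → Fin K) × (Fin n → Bool)) :
    MvPolynomial (Fin n) F :=
  ∑ i, if ((ρ.1 i).val = 0 ∧ ρ.2 i = true) then MvPolynomial.X i else 0

lemma rowP_deg (F : Type) [Field F] {n K : ℕ} (ρ : (Fin n → Fin K) × (Fin n → Bool)) :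
    (rowP F ρ).totalDegree ≤ 1 := by
  refine MvPolynomial.totalDegree_finsetSum_le ?_
  intro i _
  split_ifs <;> simp

lemma rowP_eval (F : Type) [Field F] {n K : ℕ} (ρ : (Fin n → Fin K) × (Fin n → Bool))
    (x : Fin n → Bool) : MvPolynomial.eval (bv F x) (rowP F ρ) = (rowv x ρ : F) := by
  rw [rowP, map_sum, rowv, wt, Finset.card_filter]
  push_cast
  refine Finset.sum_congr rfl fun i _ => ?_
  by_cases h1 : (ρ.1 i).val = 0 <;> cases h2 : ρ.2 i <;> cases h3 : x i <;>
    simp [h1, h2, h3, mask, bv, bF]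

lemma rowP_pow_eval {F : Type} [Field F] (p : ℕ) (hp : p.Prime) [CharP F p] {n K : ℕ}
    (ρ : (Fin n → Fin K) × (Fin n → Bool)) (x : Fin n → Bool) :
    MvPolynomial.eval (bv F x) (rowP F ρ ^ (p-1)) = bF F (decide (¬ p ∣ rowv x ρ)) := by
  have : Fact p.Prime := ⟨hp⟩
  have : ExpChar F p := ExpChar.prime hp
  rw [map_pow, rowP_eval]
  have hpp : p - 1 ≠ 0 := by have := hp.one_lt; omega
  by_cases h : p ∣ rowv x ρ
  · rw [(CharP.cast_eq_zero_iff F p _).2 h, zero_pow hpp]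
    simp [h, bF]
  · have h0 : (rowv x ρ : F) ≠ 0 := fun hc => h ((CharP.cast_eq_zero_iff F p _).1 hc)
    have h1 : (rowv x ρ : F)^p = rowv x ρ := by
      have := map_natCast (frobenius F p) (rowv x ρ)
      rwa [frobenius_def] at this
    have h2 : (rowv x ρ : F)^(p-1) * rowv x ρ = 1 * rowv x ρ := by
      rw [← pow_succ, Nat.sub_add_cancel hp.one_lt.le, h1, one_mul]
    rw [mul_right_cancel₀ h0 h2]
    simp [h, bF]

lemma basep {F : Type} [Field F] (p : ℕ) (hp : p.Prime) [CharP F p] {n : ℕ} :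
    ∀ ℓ : ℕ, 8 ≤ ℓ → ∀ t ≤ 256 * ℓ, Appr F n t (65552 * p * ℓ) ((1/2)^ℓ) := by
  classical
  intro ℓ hℓ t ht
  set T := 256 * ℓ with hT
  set K := 256 * T with hKdef
  have hK : 1 ≤ K := by omega
  have hKp : (0:ℝ) < K := by exact_mod_cast hK
  have hp1 : (1:ℝ) ≤ p := by exact_mod_cast hp.one_lt.le
  obtain ⟨A, hA1, hA2⟩ := interpThr F (16*ℓ) 0 (16*ℓ) ℓ
  have hN : (Fintype.card ((Fin n → Fin K) × (Fin n → Bool)) : ℝ) = (K:ℝ)^n * 2^n := by simp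
  set N : ℝ := (K:ℝ)^n * 2^n with hNdef
  have hNpos : 0 < N := by positivity
  have hNZ : NeZero K := ⟨by omega⟩
  have hcardΩ : (Fintype.card (Fin (16*ℓ) → (Fin n → Fin K) × (Fin n → Bool)) : ℝ)
      = N^(16*ℓ) := by
    rw [Fintype.card_fun, Fintype.card_fin]
    push_cast [hN]
    rfl
  have hsum : ∀ x : Fin n → Bool, ((Finset.univ.filter fun ρ : (Fin n → Fin K) × (Fin n → Bool) =>
      p ∣ rowv x ρ).card : ℝ) + (Finset.univ.filter fun ρ : (Fin n → Fin K) × (Fin n → Bool) =>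
      ¬ p ∣ rowv x ρ).card = N := by
    intro x
    rw [← hN]
    exact_mod_cast Finset.card_filter_add_card_filter_not
      (s := (Finset.univ : Finset ((Fin n → Fin K) × (Fin n → Bool)))) (fun ρ => p ∣ rowv x ρ)
  have := base_of_Z (F := F) (n := n) (T := T) (D := K) (dZ := 16 * ℓ * (p-1 : ℕ)) (ε := (1/2)^ℓ)
    (Fin (16*ℓ) → (Fin n → Fin K) × (Fin n → Bool))
    (fun ω => 1 - MvPolynomial.bind₁ (fun b => rowP F (ω b) ^ (p-1)) A) ?_ (by omega) ?_ t ht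
  · refine this.mono ?_
    have h1 : ((p-1 : ℕ) : ℝ) ≤ p := by exact_mod_cast Nat.sub_le p 1
    have h2 : (K : ℝ) = 65536 * ℓ := by
      rw [hKdef, hT]; push_cast; ring
    have h3 : (0:ℝ) ≤ ℓ := by positivity
    have h4 := mul_le_mul_of_nonneg_left h1 h3
    have h5 := mul_le_mul_of_nonneg_left hp1 h3
    rw [h2]
    linarith
  · intro ω
    have h1 := MvPolynomial.totalDegree_sub 1
      (MvPolynomial.bind₁ (fun b => rowP F (ω b) ^ (p-1)) A)
    have h2 := totalDegree_bind_le (fun b => rowP F (ω b) ^ (p-1)) (p-1) (fun b =>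
      (MvPolynomial.totalDegree_pow _ _).trans
        ((Nat.mul_le_mul_left _ (rowP_deg F (ω b))).trans (by omega))) A
    have h3 := Nat.mul_le_mul_right (p-1) hA1
    rw [MvPolynomial.totalDegree_one] at h1
    have h4 : (1 - MvPolynomial.bind₁ (fun b => rowP F (ω b) ^ (p-1)) A).totalDegree
      ≤ 16 * ℓ * (p-1) := h1.trans (max_le (Nat.zero_le _) (h2.trans h3))
    exact_mod_cast h4
  · intro x
    have hev : ∀ ω : Fin (16*ℓ) → (Fin n → Fin K) × (Fin n → Bool),
        MvPolynomial.eval (bv F x) (1 - MvPolynomial.bind₁ (fun b => rowP F (ω b) ^ (p-1)) A)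
        = 1 - bF F (Thr (16*ℓ) ℓ (rowY p x ω)) := by
      intro ω
      have h1 : MvPolynomial.eval (bv F x) (MvPolynomial.bind₁ (fun b => rowP F (ω b) ^ (p-1)) A)
          = MvPolynomial.eval (bv F (rowY p x ω)) A := by
        rw [MvPolynomial.eval, MvPolynomial.eval₂Hom_bind₁]
        congr 2
        ext b
        exact rowP_pow_eval p hp (ω b) x
      rw [map_sub, map_one, h1, hA2 _ (Nat.zero_le _) (by have := wt_le (rowY p x ω); omega)]
    rw [hcardΩ]
    by_cases hw : wt x < T
    · have hm := markov (fun ω : Fin (16*ℓ) → (Fin n → Fin K) × (Fin n → Bool) =>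
        ℓ ≤ wt (rowY p x ω)) (fun ω => (16:ℝ) ^ wt (rowY p x ω)) (16^ℓ) (fun ω => by positivity)
        (fun ω h => pow_le_pow_right₀ (by norm_num) h)
      rw [rowY_mgf] at hm
      have hle : ((Finset.univ.filter fun ω : Fin (16*ℓ) → (Fin n → Fin K) × (Fin n → Bool) =>
          ℓ ≤ wt (rowY p x ω)).card : ℝ) ≤ (1/2)^ℓ * N^(16*ℓ) := by
        have hrow := row_nonzero (p := p) hK x
        have hr2 : (wt x : ℝ) / K ≤ 1/256 := by
          rw [div_le_iff₀ hKp]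
          have : 256 * wt x ≤ K := by omega
          have h' : (256 * wt x : ℝ) ≤ K := by exact_mod_cast this
          linarith
        have hr3 := mul_le_mul_of_nonneg_left hr2 hNpos.le
        have hs := hsum x
        have hp16 : (0:ℝ) < 16^ℓ := by positivity
        refine le_of_mul_le_mul_right (hm.trans ?_) hp16
        calc _ ≤ (N * (271/256))^(16*ℓ) := by
              apply pow_le_pow_left₀ (by positivity)
              linarith
          _ = N^(16*ℓ) * ((271/256)^16)^ℓ := by rw [mul_pow, pow_mul (271/256:ℝ)]
          _ ≤ N^(16*ℓ) * 8^ℓ := by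
            gcongr
            norm_num
          _ = (1/2)^ℓ * N^(16*ℓ) * 16^ℓ := by
            rw [show (8:ℝ)^ℓ = (1/2)^ℓ * 16^ℓ by rw [← mul_pow]; norm_num]; ring
      refine le_trans ?_ hle
      norm_cast
      apply Finset.card_le_card
      intro ω hω
      rw [Finset.mem_filter] at hω ⊢
      refine ⟨Finset.mem_univ _, ?_⟩
      by_contra hcon
      refine hω.2 ⟨fun _ => ?_, fun h => by omega⟩
      rw [hev]
      simp [Thr, hcon, bF]
    · by_cases hw2 : K < wt x
      · have hm := markov (fun ω : Fin (16*ℓ) → (Fin n → Fin K) × (Fin n → Bool) =>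
          wt (rowY p x ω) < ℓ) (fun ω => (1/2:ℝ) ^ wt (rowY p x ω)) ((1/2)^ℓ)
          (fun ω => by positivity)
          (fun ω h => pow_le_pow_of_le_one (by norm_num) (by norm_num) h.le)
        rw [rowY_mgf] at hm
        have hle : ((Finset.univ.filter fun ω : Fin (16*ℓ) → (Fin n → Fin K) × (Fin n → Bool) =>
            wt (rowY p x ω) < ℓ).card : ℝ) ≤ (1/2)^ℓ * N^(16*ℓ) := by
          have hrow := row_zero hp hK x
          have hr2 : (1 - 1/(K:ℝ))^wt x ≤ 1/2 := by
            rw [sub_eq_add_neg]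
            refine (one_add_pow_le_exp _ ?_ _).trans ?_
            · have : 1/(K:ℝ) ≤ 1 := by
                rw [div_le_one hKp]; exact_mod_cast hK
              linarith
            · have h1 := exp_le_half_pow 1 (wt x / K) (by
                rw [le_div_iff₀ hKp]
                have : (K:ℝ) < wt x := by exact_mod_cast hw2
                push_cast
                linarith)
              rw [pow_one] at h1
              rw [show (wt x : ℝ) * -(1/K) = -(wt x / K) by ring]
              exact h1
          have hr3 := mul_le_mul_of_nonneg_left hr2 hNpos.le
          have hs := hsum x
          have hp16 : (0:ℝ) < (1/2)^ℓ := by positivity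
          refine le_of_mul_le_mul_right (hm.trans ?_) hp16
          calc _ ≤ (N * (7/8))^(16*ℓ) := by
                apply pow_le_pow_left₀ (by positivity)
                linarith
            _ = N^(16*ℓ) * ((7/8)^16)^ℓ := by rw [mul_pow, pow_mul (7/8:ℝ)]
            _ ≤ N^(16*ℓ) * (1/4)^ℓ := by
              gcongr
              norm_num
            _ = (1/2)^ℓ * N^(16*ℓ) * (1/2)^ℓ := by
              rw [show (1/4:ℝ)^ℓ = (1/2)^ℓ * (1/2)^ℓ by rw [← mul_pow]; norm_num]; ring
        refine le_trans ?_ hle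
        norm_cast
        apply Finset.card_le_card
        intro ω hω
        rw [Finset.mem_filter] at hω ⊢
        refine ⟨Finset.mem_univ _, ?_⟩
        by_contra hcon
        refine hω.2 ⟨fun h => by omega, fun _ => ?_⟩
        rw [hev]
        have : ℓ ≤ wt (rowY p x ω) := by omega
        simp [Thr, this, bF]
      · rw [Finset.filter_false_of_mem]
        · simp; positivity
        · intro ω _ hcon
          exact hcon ⟨fun h => absurd h hw, fun h => absurd h hw2⟩

/-- upper bounds on the probabilistic degree of `(n,t)`-threshold
tuples, over fixed positive characteristic (i) and characteristic 0 (ii). -/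
theorem stmt0 :
    (∀ p : ℕ, p.Prime →
      ∃ A : ℝ, 0 < A ∧
        ∀ (F : Type) [Field F] [CharP F p],
          ∀ n : ℕ, 1 ≤ n → ∀ t : ℕ, t ≤ n →
            ∀ (m : ℕ) (ts : Fin m → ℕ), (∀ j, ts j ≤ t) →
              ∀ ε : ℝ, 0 < ε → ε < 1/3 →
                (pdegTuple F (fun a j => Thr n (ts j) a) ε : ℝ)
                  ≤ A * (Real.sqrt (t * Real.logb 2 (1/ε)) + Real.logb 2 (1/ε)))
    ∧
    (∃ A : ℝ, 0 < A ∧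
      ∀ (F : Type) [Field F] [CharP F 0],
        ∀ n : ℕ, 2 ≤ n → ∀ t : ℕ, t ≤ n →
          ∀ (m : ℕ) (ts : Fin m → ℕ), (∀ j, ts j ≤ t) →
            ∀ ε : ℝ, 0 < ε → ε < 1/3 →
              (pdegTuple F (fun a j => Thr n (ts j) a) ε : ℝ)
                ≤ A * Real.logb 2 n *
                    (Real.sqrt (t * Real.logb 2 (1/ε)) + Real.logb 2 (1/ε))) := by
  refine ⟨?_, ?_⟩
  · intro p hp
    have hp1 : (1:ℝ) ≤ p := by exact_mod_cast hp.one_lt.le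
    refine ⟨1280 * (65552 * p), by positivity, ?_⟩
    intro F _ _ n _ t _ m ts hts ε h0 h1
    exact final (F := F) (n := n) (M := 65552 * p) (by linarith) (basep p hp) ts hts h0 h1
  · refine ⟨1280 * 6192, by norm_num, ?_⟩
    intro F _ _ n hn t _ m ts hts ε h0 h1
    have hlog : 1 ≤ Real.logb 2 n := by
      rw [Real.le_logb_iff_rpow_le (by norm_num) (by positivity), Real.rpow_one]
      exact_mod_cast hn
    have := final (F := F) (M := 6192 * Real.logb 2 n) (by linarith) (base0 hn) ts hts h0 h1
    rw [← mul_assoc] at this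
    exact this
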